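/- arXiv:2603.09158 — 2 statements merged into one kernel-verified Lean document; each statement's English description precedes it below -/
import Mathlib

section
/- Let 𝐗 = (X,𝕏) be a level-2 α-Hölder rough path over V, let 𝐘 = (Y,Y') be an 𝐗-controlled rough path with values in L(W,U) and let 𝐙 = (Z,Z') be an 𝐗-controlled rough path with values in W. Define I : [0,T] → U by I_t := ∫_0^t Y dZ and I' : [0,T] → L(V,U) by I'_t := (v ↦ Y_t(Z'_t(v))). Then 𝐈 = (I, I') is an 𝐗-controlled rough path with values in U; that is, ‖I'‖_α < ∞ and ‖R^{𝐈}‖_{2α} < ∞, where R^{𝐈}_{s,t} := I_{s,t} − I'_s(X_{s,t}). -/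
/-!  Common definitions: level-2 rough paths, controlled rough paths,
compensated Riemann sums and rough integrals of a controlled rough path
against another controlled rough path. -/

open scoped BigOperators

noncomputable section

/-- `HBound T β A` : the two-parameter map `A` satisfies a `β`-Hölder bound on the
simplex `{0 ≤ s < t ≤ T}`. -/
def HBound {E : Type*} [NormedAddCommGroup E] (T β : ℝ) (A : ℝ → ℝ → E) : Prop :=
  ∃ C : ℝ, ∀ s t : ℝ, 0 ≤ s → s < t → t ≤ T → ‖A s t‖ ≤ C * (t - s) ^ β

/-- The Hölder seminorm `‖A‖_β = sup_{0 ≤ s < t ≤ T} ‖A_{s,t}‖ / (t-s)^β`, realised as the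
least admissible Hölder constant. -/
def hnorm {E : Type*} [NormedAddCommGroup E] (T β : ℝ) (A : ℝ → ℝ → E) : ℝ :=
  sInf {C : ℝ | 0 ≤ C ∧ ∀ s t : ℝ, 0 ≤ s → s < t → t ≤ T → ‖A s t‖ ≤ C * (t - s) ^ β}

/-- An abstract model of the projective tensor product `V ⊗̂ V`, bundling the canonical
bounded bilinear map `tmul : V × V → V ⊗̂ V` and the pairing `⋆` sending
`A ∈ L(V, L(W,U))` and `B ∈ L(V,W)` to the induced operator `A ⋆ B ∈ L(V ⊗̂ V, U)`,
characterised by `(A ⋆ B)(v₁ ⊗ v₂) = (A v₁)(B v₂)` and `‖A ⋆ B‖ ≤ ‖A‖ ‖B‖`. -/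
structure TensorOps (V V2 W U : Type*)
    [NormedAddCommGroup V] [NormedSpace ℝ V] [NormedAddCommGroup V2] [NormedSpace ℝ V2]
    [NormedAddCommGroup W] [NormedSpace ℝ W] [NormedAddCommGroup U] [NormedSpace ℝ U] where
  tmul : V →L[ℝ] V →L[ℝ] V2
  tmul_le : ∀ a b : V, ‖tmul a b‖ ≤ ‖a‖ * ‖b‖
  spair : (V →L[ℝ] (W →L[ℝ] U)) →L[ℝ] ((V →L[ℝ] W) →L[ℝ] (V2 →L[ℝ] U))
  spair_tmul : ∀ (A : V →L[ℝ] (W →L[ℝ] U)) (B : V →L[ℝ] W) (a b : V),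
    spair A B (tmul a b) = (A a) (B b)
  spair_le : ∀ (A : V →L[ℝ] (W →L[ℝ] U)) (B : V →L[ℝ] W), ‖spair A B‖ ≤ ‖A‖ * ‖B‖

section Defs

variable {V V2 E : Type*}
  [NormedAddCommGroup V] [NormedSpace ℝ V] [NormedAddCommGroup V2] [NormedSpace ℝ V2]
  [NormedAddCommGroup E] [NormedSpace ℝ E]

/-- `(X, XX)` is a level-2 `α`-Hölder rough path on `[0,T]`:
Chen's relation plus the analytic estimates. -/
structure IsRoughPath (T α : ℝ) (tmul : V →L[ℝ] V →L[ℝ] V2)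
    (X : ℝ → V) (XX : ℝ → ℝ → V2) : Prop where
  chen : ∀ s u t : ℝ, 0 ≤ s → s ≤ u → u ≤ t → t ≤ T →
    XX s t = XX s u + XX u t + tmul (X u - X s) (X t - X u)
  x_hold : HBound T α fun s t => X t - X s
  xx_hold : HBound T (2 * α) XX

/-- `‖𝐗‖_α := ‖X‖_α + ‖𝕏‖_{2α}`. -/
def rpNorm (T α : ℝ) (X : ℝ → V) (XX : ℝ → ℝ → V2) : ℝ :=
  hnorm T α (fun s t => X t - X s) + hnorm T (2 * α) XX

/-- `‖𝐗 − 𝐗̃‖_α := ‖X − X̃‖_α + ‖𝕏 − 𝕏̃‖_{2α}`. -/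
def rpDist (T α : ℝ) (X Xt : ℝ → V) (XX XXt : ℝ → ℝ → V2) : ℝ :=
  hnorm T α (fun s t => (X t - X s) - (Xt t - Xt s)) +
    hnorm T (2 * α) fun s t => XX s t - XXt s t

/-- The remainder `R^{𝐘}_{s,t} := Y_{s,t} − Y'_s(X_{s,t})` of a controlled rough path. -/
def Rem (X : ℝ → V) (Y : ℝ → E) (Y' : ℝ → V →L[ℝ] E) (s t : ℝ) : E :=
  Y t - Y s - Y' s (X t - X s)

/-- `(Y, Y')` is an `𝐗`-controlled rough path on `[0,T]` with values in `E`. -/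
structure IsCRP (T α : ℝ) (X : ℝ → V) (Y : ℝ → E) (Y' : ℝ → V →L[ℝ] E) : Prop where
  deriv_hold : HBound T α fun s t => Y' t - Y' s
  rem_hold : HBound T (2 * α) (Rem X Y Y')

/-- `‖𝐘‖_{𝐗;α} := ‖R^{𝐘}‖_{2α} + ‖Y'‖_α`. -/
def crpNorm (T α : ℝ) (X : ℝ → V) (Y : ℝ → E) (Y' : ℝ → V →L[ℝ] E) : ℝ :=
  hnorm T (2 * α) (Rem X Y Y') + hnorm T α fun s t => Y' t - Y' s

/-- `d_{𝐗,𝐗̃;α}(𝐘,𝐘̃) := ‖R^{𝐘} − R^{𝐘̃}‖_{2α} + ‖Y' − Ỹ'‖_α`. -/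
def crpDist (T α : ℝ) (X Xt : ℝ → V) (Y : ℝ → E) (Y' : ℝ → V →L[ℝ] E)
    (Yt : ℝ → E) (Yt' : ℝ → V →L[ℝ] E) : ℝ :=
  hnorm T (2 * α) (fun s t => Rem X Y Y' s t - Rem Xt Yt Yt' s t) +
    hnorm T α fun s t => (Y' t - Y' s) - (Yt' t - Yt' s)

/-- `p` is a finite partition `s = p 0 < p 1 < ⋯ < p n = t` of `[s,t]`. -/
def IsPartition (s t : ℝ) (n : ℕ) (p : ℕ → ℝ) : Prop :=
  p 0 = s ∧ p n = t ∧ ∀ i < n, p i < p (i + 1)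

end Defs

section Sums

variable {V V2 W U : Type*}
  [NormedAddCommGroup V] [NormedSpace ℝ V] [NormedAddCommGroup V2] [NormedSpace ℝ V2]
  [NormedAddCommGroup W] [NormedSpace ℝ W] [NormedAddCommGroup U] [NormedSpace ℝ U]

/-- The compensated Riemann sum
`∫_P Y dZ := Σ_i [ Y_{t_i}(Z_{t_i,t_{i+1}}) + (Y'_{t_i} ⋆ Z'_{t_i})(𝕏_{t_i,t_{i+1}}) ]`. -/
def rsum (tops : TensorOps V V2 W U) (XX : ℝ → ℝ → V2)
    (Y : ℝ → W →L[ℝ] U) (Y' : ℝ → V →L[ℝ] (W →L[ℝ] U))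
    (Z : ℝ → W) (Z' : ℝ → V →L[ℝ] W) (n : ℕ) (p : ℕ → ℝ) : U :=
  ∑ i ∈ Finset.range n,
    ((Y (p i)) (Z (p (i + 1)) - Z (p i)) +
      (tops.spair (Y' (p i)) (Z' (p i))) (XX (p i) (p (i + 1))))

/-- `I` is the rough integral `∫_s^t Y dZ`: the limit of the compensated Riemann sums
as the mesh of the partition tends to `0`. -/
def IsRoughIntegral (tops : TensorOps V V2 W U) (XX : ℝ → ℝ → V2)
    (Y : ℝ → W →L[ℝ] U) (Y' : ℝ → V →L[ℝ] (W →L[ℝ] U))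
    (Z : ℝ → W) (Z' : ℝ → V →L[ℝ] W) (s t : ℝ) (I : U) : Prop :=
  ∀ ε : ℝ, 0 < ε → ∃ δ : ℝ, 0 < δ ∧ ∀ (n : ℕ) (p : ℕ → ℝ), IsPartition s t n p →
    (∀ i < n, p (i + 1) - p i < δ) → ‖rsum tops XX Y Y' Z Z' n p - I‖ ≤ ε

end Sums

/-- The constant `C_α := (1 + T^α + T^{2α}) · 2^{3α} · Σ_{n≥1} n^{-3α}`. -/
def Calpha (T α : ℝ) : ℝ :=
  (1 + T ^ α + T ^ (2 * α)) * (2 : ℝ) ^ (3 * α) * ∑' n : ℕ, ((n : ℝ) + 1) ^ (-(3 * α))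

/-- `F ∈ C_b^k`: `k` times continuously Fréchet differentiable with all derivatives
up to order `k` bounded. -/
def IsCb {E₁ E₂ : Type*} [NormedAddCommGroup E₁] [NormedSpace ℝ E₁]
    [NormedAddCommGroup E₂] [NormedSpace ℝ E₂] (k : ℕ) (F : E₁ → E₂) : Prop :=
  ContDiff ℝ (k : ℕ∞) F ∧ ∀ j ≤ k, ∃ C : ℝ, ∀ x, ‖iteratedFDeriv ℝ j F x‖ ≤ C

/-- `‖F‖_{C_b^k} := Σ_{j=0}^k sup_x ‖D^j F(x)‖`. -/
def cbNorm {E₁ E₂ : Type*} [NormedAddCommGroup E₁] [NormedSpace ℝ E₁]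
    [NormedAddCommGroup E₂] [NormedSpace ℝ E₂] (k : ℕ) (F : E₁ → E₂) : ℝ :=
  ∑ j ∈ Finset.range (k + 1), ⨆ x : E₁, ‖iteratedFDeriv ℝ j F x‖

end

section Hoelder

variable {E F : Type*} [NormedAddCommGroup E] [NormedAddCommGroup F] {T β γ : ℝ}

/-- A Hölder bound, with a nonnegative constant and uniform in an upper bound `h` for the length
of the interval. -/
theorem HBound.exists_le {A : ℝ → ℝ → E} (hA : HBound T β A) (hβ : 0 ≤ β) :
    ∃ C : ℝ, 0 ≤ C ∧ ∀ s t h : ℝ, 0 ≤ s → s < t → t ≤ T → t - s ≤ h → ‖A s t‖ ≤ C * h ^ β := by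
  obtain ⟨C, hC⟩ := hA
  refine ⟨|C|, abs_nonneg C, fun s t h hs hst ht hh => (hC s t hs hst ht).trans ?_⟩
  have hpos : 0 ≤ t - s := by linarith
  gcongr
  exact le_abs_self C

theorem HBound.add {A B : ℝ → ℝ → E} (hA : HBound T β A) (hB : HBound T β B) :
    HBound T β fun s t => A s t + B s t := by
  obtain ⟨C, hC⟩ := hA
  obtain ⟨D, hD⟩ := hB
  refine ⟨C + D, fun s t hs hst ht => (norm_add_le _ _).trans ?_⟩
  rw [add_mul]
  exact add_le_add (hC s t hs hst ht) (hD s t hs hst ht)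

theorem HBound.congr {A B : ℝ → ℝ → E} (hA : HBound T β A)
    (h : ∀ s t, 0 ≤ s → s < t → t ≤ T → B s t = A s t) : HBound T β B := by
  obtain ⟨C, hC⟩ := hA
  exact ⟨C, fun s t hs hst ht => by rw [h s t hs hst ht]; exact hC s t hs hst ht⟩

theorem HBound.of_norm_le {A : ℝ → ℝ → E} {B : ℝ → ℝ → F} {M : ℝ} (hA : HBound T β A)
    (hM : 0 ≤ M) (h : ∀ s t, 0 ≤ s → s < t → t ≤ T → ‖B s t‖ ≤ M * ‖A s t‖) :
    HBound T β B := by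
  obtain ⟨C, hC⟩ := hA
  refine ⟨M * C, fun s t hs hst ht => (h s t hs hst ht).trans ?_⟩
  rw [mul_assoc]
  exact mul_le_mul_of_nonneg_left (hC s t hs hst ht) hM

theorem HBound.mono_exponent {A : ℝ → ℝ → E} (hA : HBound T γ A) (hβ : 0 ≤ β) (h : β ≤ γ) :
    HBound T β A := by
  obtain ⟨C, hC, hA⟩ := hA.exists_le (hβ.trans h)
  refine ⟨C * T ^ (γ - β), fun s t hs hst ht => (hA s t _ hs hst ht le_rfl).trans ?_⟩
  have hpos : 0 < t - s := by linarith
  have hle : (t - s) ^ (γ - β) ≤ T ^ (γ - β) :=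
    Real.rpow_le_rpow hpos.le (by linarith) (by linarith)
  calc C * (t - s) ^ γ = C * ((t - s) ^ (γ - β) * (t - s) ^ β) := by
        rw [← Real.rpow_add hpos, sub_add_cancel]
    _ ≤ C * (T ^ (γ - β) * (t - s) ^ β) := by gcongr
    _ = C * T ^ (γ - β) * (t - s) ^ β := by ring

/-- A Hölder continuous path is bounded on `[0,T]`. -/
theorem HBound.bounded {f : ℝ → E} (hf : HBound T β fun s t => f t - f s) (hβ : 0 ≤ β) :
    ∃ M : ℝ, 0 ≤ M ∧ ∀ t, 0 ≤ t → t ≤ T → ‖f t‖ ≤ M := by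
  obtain ⟨C, hC, hf⟩ := hf.exists_le hβ
  refine ⟨‖f 0‖ + |C * T ^ β|, by positivity, fun t ht htT => ?_⟩
  rcases ht.eq_or_lt with rfl | ht
  · linarith [abs_nonneg (C * T ^ β)]
  · have h1 := hf 0 t T le_rfl ht htT (by linarith)
    have h2 : ‖f t‖ ≤ ‖f 0‖ + ‖f t - f 0‖ := by
      simpa using norm_add_le (f 0) (f t - f 0)
    linarith [le_abs_self (C * T ^ β)]

end Hoelder

/-- A controlled path inherits the Hölder regularity of the driving path. -/
theorem IsCRP.path_hold {V E : Type*} [NormedAddCommGroup V] [NormedSpace ℝ V]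
    [NormedAddCommGroup E] [NormedSpace ℝ E] {T α : ℝ} {X : ℝ → V} {Y : ℝ → E}
    {Y' : ℝ → V →L[ℝ] E} (hY : IsCRP T α X Y Y') (hX : HBound T α fun s t => X t - X s)
    (hα : 0 ≤ α) : HBound T α fun s t => Y t - Y s := by
  obtain ⟨M, hM, hbd⟩ := hY.deriv_hold.bounded hα
  have h1 : HBound T α fun s t => Y' s (X t - X s) :=
    hX.of_norm_le hM fun s t hs hst ht =>
      (Y' s).le_of_opNorm_le (hbd s hs (by linarith)) _
  refine ((hY.rem_hold.mono_exponent hα (by linarith)).add h1).congr fun s t _ _ _ => ?_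
  simp [Rem]

section Sewing

variable {U : Type*} [NormedAddCommGroup U]

/-- Two adjacent partitions can be concatenated; Riemann sums of a two-parameter map add up. -/
theorem IsPartition.exists_concat (Ξ : ℝ → ℝ → U) {s u t d : ℝ} {n m : ℕ} {p q : ℕ → ℝ}
    (hp : IsPartition s u n p) (hq : IsPartition u t m q)
    (hpd : ∀ i < n, p (i + 1) - p i ≤ d) (hqd : ∀ i < m, q (i + 1) - q i ≤ d) :
    ∃ r : ℕ → ℝ, IsPartition s t (n + m) r ∧ (∀ i < n + m, r (i + 1) - r i ≤ d) ∧
      ∑ i ∈ Finset.range (n + m), Ξ (r i) (r (i + 1)) =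
        ∑ i ∈ Finset.range n, Ξ (p i) (p (i + 1)) +
          ∑ i ∈ Finset.range m, Ξ (q i) (q (i + 1)) := by
  obtain ⟨hp0, hpn, hpi⟩ := hp
  obtain ⟨hq0, hqm, hqi⟩ := hq
  set r : ℕ → ℝ := fun i => if i ≤ n then p i else q (i - n) with hr
  have hleft : ∀ i ≤ n, r i = p i := fun i hi => by simp [hr, hi]
  have hright : ∀ i, r (n + i) = q i := by
    rintro (_ | i)
    · simp [hr, hpn, hq0]
    · simp [hr]
  have hcases : ∀ P : ℝ → ℝ → Prop, (∀ i < n, P (p i) (p (i + 1))) →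
      (∀ i < m, P (q i) (q (i + 1))) → ∀ i < n + m, P (r i) (r (i + 1)) := by
    intro P h1 h2 i hi
    rcases lt_or_ge i n with h | h
    · rw [hleft i h.le, hleft (i + 1) h]
      exact h1 i h
    · obtain ⟨j, rfl⟩ := Nat.exists_eq_add_of_le h
      rw [add_assoc, hright, hright]
      exact h2 j (by omega)
  refine ⟨r, ⟨by rw [hleft 0 n.zero_le, hp0], by rw [hright, hqm],
    hcases (fun a b => a < b) hpi hqi⟩, hcases (fun a b => b - a ≤ d) hpd hqd, ?_⟩
  rw [Finset.sum_range_add]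
  congr 1
  · refine Finset.sum_congr rfl fun i hi => ?_
    have hi := Finset.mem_range.1 hi
    rw [hleft i hi.le, hleft (i + 1) hi]
  · exact Finset.sum_congr rfl fun i _ => by rw [add_assoc, hright, hright]

/-- The sewing estimate along dyadic partitions. -/
theorem exists_partition_sum_sub_le (Ξ : ℝ → ℝ → U) {T θ C : ℝ} (hθ : 1 < θ)
    (hΞ : ∀ s t : ℝ, 0 ≤ s → s < t → t ≤ T →
      ‖Ξ s ((s + t) / 2) + Ξ ((s + t) / 2) t - Ξ s t‖ ≤ C * (t - s) ^ θ) (k : ℕ) :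
    ∀ s t : ℝ, 0 ≤ s → s < t → t ≤ T → ∃ (n : ℕ) (p : ℕ → ℝ), IsPartition s t n p ∧
      (∀ i < n, p (i + 1) - p i ≤ (t - s) / 2 ^ k) ∧
      ‖∑ i ∈ Finset.range n, Ξ (p i) (p (i + 1)) - Ξ s t‖ ≤
        C / (1 - 2 * (1 / 2) ^ θ) * (t - s) ^ θ := by
  have hhalf : 2 * (1 / 2 : ℝ) ^ θ < 1 := by
    have := Real.rpow_lt_rpow_of_exponent_gt (x := 1 / 2) (by norm_num) (by norm_num) hθ
    rw [Real.rpow_one] at this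
    linarith
  have hfix : C / (1 - 2 * (1 / 2) ^ θ) * (2 * (1 / 2) ^ θ) + C = C / (1 - 2 * (1 / 2) ^ θ) := by
    have : 1 - 2 * (1 / 2 : ℝ) ^ θ ≠ 0 := by linarith
    field_simp
    ring
  set K := C / (1 - 2 * (1 / 2) ^ θ) with hK
  induction k with
  | zero =>
    intro s t hs hst ht
    have hC : 0 ≤ C * (t - s) ^ θ := (norm_nonneg _).trans (hΞ s t hs hst ht)
    refine ⟨1, fun i => if i = 0 then s else t, ⟨by simp, by simp, by simpa using hst⟩,
      by simp, ?_⟩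
    have : 0 ≤ C * (t - s) ^ θ / (1 - 2 * (1 / 2) ^ θ) := div_nonneg hC (by linarith)
    simpa [hK, div_mul_eq_mul_div] using this
  | succ k ih =>
    intro s t hs hst ht
    have hlen1 : (s + t) / 2 - s = (t - s) * (1 / 2) := by ring
    have hlen2 : t - (s + t) / 2 = (t - s) * (1 / 2) := by ring
    obtain ⟨n, p, hp, hpd, hpΞ⟩ := ih s ((s + t) / 2) hs (by linarith) (by linarith)
    obtain ⟨m, q, hq, hqd, hqΞ⟩ := ih ((s + t) / 2) t (by linarith) (by linarith) ht
    have hmesh : (t - s) * (1 / 2) / 2 ^ k = (t - s) / 2 ^ (k + 1) := by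
      rw [pow_succ]
      ring
    rw [hlen1, hmesh] at hpd
    rw [hlen2, hmesh] at hqd
    obtain ⟨r, hr, hrd, hrΞ⟩ := hp.exists_concat Ξ hq hpd hqd
    refine ⟨n + m, r, hr, hrd, ?_⟩
    have hpow : ((t - s) * (1 / 2)) ^ θ = (t - s) ^ θ * (1 / 2) ^ θ :=
      Real.mul_rpow (by linarith) (by norm_num)
    rw [hlen1, hpow] at hpΞ
    rw [hlen2, hpow] at hqΞ
    rw [hrΞ]
    set Sp := ∑ i ∈ Finset.range n, Ξ (p i) (p (i + 1))
    set Sq := ∑ i ∈ Finset.range m, Ξ (q i) (q (i + 1))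
    calc ‖Sp + Sq - Ξ s t‖
        = ‖(Sp - Ξ s ((s + t) / 2)) + (Sq - Ξ ((s + t) / 2) t) +
            (Ξ s ((s + t) / 2) + Ξ ((s + t) / 2) t - Ξ s t)‖ := by
          congr 1
          abel
      _ ≤ _ := norm_add₃_le
      _ ≤ K * ((t - s) ^ θ * (1 / 2) ^ θ) + K * ((t - s) ^ θ * (1 / 2) ^ θ) +
            C * (t - s) ^ θ := add_le_add_three hpΞ hqΞ (hΞ s t hs hst ht)
      _ = (K * (2 * (1 / 2) ^ θ) + C) * (t - s) ^ θ := by ring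
      _ = K * (t - s) ^ θ := by rw [hfix]

/-- If `J` is the limit of Riemann sums of `Ξ` over partitions of `[0,t]`, and `Ξ` is almost
additive, then the increments of `J` are close to `Ξ`. -/
theorem norm_increment_sub_le (Ξ : ℝ → ℝ → U) {T θ C : ℝ} (hθ : 1 < θ)
    (hΞ : ∀ s t : ℝ, 0 ≤ s → s < t → t ≤ T →
      ‖Ξ s ((s + t) / 2) + Ξ ((s + t) / 2) t - Ξ s t‖ ≤ C * (t - s) ^ θ) (J : ℝ → U)
    (hJ : ∀ t : ℝ, 0 ≤ t → t ≤ T → ∀ ε : ℝ, 0 < ε → ∃ δ : ℝ, 0 < δ ∧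
      ∀ (n : ℕ) (p : ℕ → ℝ), IsPartition 0 t n p → (∀ i < n, p (i + 1) - p i < δ) →
        ‖∑ i ∈ Finset.range n, Ξ (p i) (p (i + 1)) - J t‖ ≤ ε)
    {s t : ℝ} (hs : 0 ≤ s) (hst : s < t) (ht : t ≤ T) :
    ‖J t - J s - Ξ s t‖ ≤ C / (1 - 2 * (1 / 2) ^ θ) * (t - s) ^ θ := by
  refine le_of_forall_pos_le_add fun ε hε => ?_
  obtain ⟨δ₁, hδ₁, h₁⟩ := hJ s hs (by linarith) (ε / 2) (by linarith)
  obtain ⟨δ₂, hδ₂, h₂⟩ := hJ t (by linarith) ht (ε / 2) (by linarith)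
  have hδ : 0 < min δ₁ δ₂ := lt_min hδ₁ hδ₂
  obtain ⟨d, hd, hdδ⟩ := exists_between hδ
  obtain ⟨k, hk⟩ := pow_unbounded_of_one_lt (T / d) (one_lt_two (α := ℝ))
  have hT : T / 2 ^ k ≤ d := by
    rw [div_lt_iff₀ hd] at hk
    rw [div_le_iff₀ (by positivity)]
    linarith
  have hmesh : ∀ a b : ℝ, 0 ≤ a → b ≤ T → (b - a) / 2 ^ k ≤ d := fun a b ha hb =>
    le_trans (by gcongr; linarith) hT
  obtain ⟨n, p, hp, hpd⟩ : ∃ (n : ℕ) (p : ℕ → ℝ), IsPartition 0 s n p ∧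
      ∀ i < n, p (i + 1) - p i ≤ d := by
    rcases hs.eq_or_lt with rfl | hs
    · exact ⟨0, fun _ => 0, ⟨rfl, rfl, by simp⟩, by simp⟩
    · obtain ⟨n, p, hp, hpd, -⟩ :=
        exists_partition_sum_sub_le Ξ hθ hΞ k 0 s le_rfl hs (by linarith)
      exact ⟨n, p, hp, fun i hi => (hpd i hi).trans (hmesh 0 s le_rfl (by linarith))⟩
  obtain ⟨m, q, hq, hqd, hqΞ⟩ := exists_partition_sum_sub_le Ξ hθ hΞ k s t hs hst ht
  obtain ⟨r, hr, hrd, hrΞ⟩ :=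
    hp.exists_concat Ξ hq hpd fun i hi => (hqd i hi).trans (hmesh s t hs ht)
  have e₁ := h₁ n p hp fun i hi => (hpd i hi).trans_lt (hdδ.trans_le (min_le_left _ _))
  have e₂ := h₂ _ r hr fun i hi => (hrd i hi).trans_lt (hdδ.trans_le (min_le_right _ _))
  rw [hrΞ] at e₂
  set Sp := ∑ i ∈ Finset.range n, Ξ (p i) (p (i + 1))
  set Sq := ∑ i ∈ Finset.range m, Ξ (q i) (q (i + 1))
  calc ‖J t - J s - Ξ s t‖ = ‖(Sq - Ξ s t) + (Sp - J s) - (Sp + Sq - J t)‖ := by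
        congr 1
        abel
    _ ≤ ‖Sq - Ξ s t‖ + ‖Sp - J s‖ + ‖Sp + Sq - J t‖ :=
        (norm_sub_le _ _).trans (add_le_add_left (norm_add_le _ _) _)
    _ ≤ C / (1 - 2 * (1 / 2) ^ θ) * (t - s) ^ θ + ε := by linarith

end Sewing

section Germ

variable {V V2 W U : Type*} [NormedAddCommGroup V] [NormedSpace ℝ V]
  [NormedAddCommGroup V2] [NormedSpace ℝ V2] [NormedAddCommGroup W] [NormedSpace ℝ W]
  [NormedAddCommGroup U] [NormedSpace ℝ U]

/-- The summand of the compensated Riemann sum of `Y` against `Z`. -/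
noncomputable def roughGerm (tops : TensorOps V V2 W U) (XX : ℝ → ℝ → V2)
    (Y : ℝ → W →L[ℝ] U) (Y' : ℝ → V →L[ℝ] (W →L[ℝ] U))
    (Z : ℝ → W) (Z' : ℝ → V →L[ℝ] W) (s t : ℝ) : U :=
  Y s (Z t - Z s) + tops.spair (Y' s) (Z' s) (XX s t)

theorem roughGerm_add_sub {tops : TensorOps V V2 W U} {X : ℝ → V} {XX : ℝ → ℝ → V2} {s u t : ℝ}
    (hchen : XX s t = XX s u + XX u t + tops.tmul (X u - X s) (X t - X u))
    (Y : ℝ → W →L[ℝ] U) (Y' : ℝ → V →L[ℝ] (W →L[ℝ] U)) (Z : ℝ → W) (Z' : ℝ → V →L[ℝ] W) :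
    roughGerm tops XX Y Y' Z Z' s u + roughGerm tops XX Y Y' Z Z' u t -
        roughGerm tops XX Y Y' Z Z' s t =
      Rem X Y Y' s u (Z t - Z u) + Y' s (X u - X s) (Rem X Z Z' u t) +
        Y' s (X u - X s) ((Z' u - Z' s) (X t - X u)) +
        (tops.spair (Y' u - Y' s) (Z' u) (XX u t) +
          tops.spair (Y' s) (Z' u - Z' s) (XX u t)) := by
  simp only [roughGerm, Rem, hchen, map_add, map_sub, tops.spair_tmul,
    sub_apply]
  abel

theorem exists_roughGerm_bound {T α : ℝ} (hα : 0 ≤ α) {tops : TensorOps V V2 W U}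
    {X : ℝ → V} {XX : ℝ → ℝ → V2} (hX : IsRoughPath T α tops.tmul X XX)
    {Y : ℝ → W →L[ℝ] U} {Y' : ℝ → V →L[ℝ] (W →L[ℝ] U)} (hY : IsCRP T α X Y Y')
    {Z : ℝ → W} {Z' : ℝ → V →L[ℝ] W} (hZ : IsCRP T α X Z Z') :
    ∃ C : ℝ, ∀ s u t : ℝ, 0 ≤ s → s < u → u < t → t ≤ T →
      ‖roughGerm tops XX Y Y' Z Z' s u + roughGerm tops XX Y Y' Z Z' u t -
        roughGerm tops XX Y Y' Z Z' s t‖ ≤ C * (t - s) ^ (3 * α) := by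
  have hα2 : 0 ≤ 2 * α := by linarith
  obtain ⟨cx, hcx, hx⟩ := hX.x_hold.exists_le hα
  obtain ⟨cxx, hcxx, hxx⟩ := hX.xx_hold.exists_le hα2
  obtain ⟨cy', hcy', hy'⟩ := hY.deriv_hold.exists_le hα
  obtain ⟨cz', hcz', hz'⟩ := hZ.deriv_hold.exists_le hα
  obtain ⟨cry, hcry, hry⟩ := hY.rem_hold.exists_le hα2
  obtain ⟨crz, hcrz, hrz⟩ := hZ.rem_hold.exists_le hα2
  obtain ⟨cz, hcz, hz⟩ := (hZ.path_hold hX.x_hold hα).exists_le hα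
  obtain ⟨my', hmy', hby'⟩ := hY.deriv_hold.bounded hα
  obtain ⟨mz', hmz', hbz'⟩ := hZ.deriv_hold.bounded hα
  refine ⟨cry * cz + my' * cx * crz + my' * cx * (cz' * cx) +
    (cy' * mz' * cxx + my' * cz' * cxx), fun s u t hs hsu hut ht => ?_⟩
  have hpos : 0 ≤ t - s := by linarith
  have hu : 0 ≤ u := by linarith
  have huT : u ≤ T := by linarith
  have hsT : s ≤ T := by linarith
  have hsu' : u - s ≤ t - s := by linarith
  have hut' : t - u ≤ t - s := by linarith
  have e2 : (t - s) ^ (2 * α) = ((t - s) ^ α) ^ 2 := by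
    rw [mul_comm, Real.rpow_mul hpos]
    norm_cast
  have e3 : (t - s) ^ (3 * α) = ((t - s) ^ α) ^ 3 := by
    rw [mul_comm, Real.rpow_mul hpos]
    norm_cast
  have ha : 0 ≤ (t - s) ^ α := Real.rpow_nonneg hpos α
  have bx₁ := hx s u _ hs hsu huT hsu'
  have bx₂ := hx u t _ hu hut ht hut'
  have bxx := hxx u t _ hu hut ht hut'
  have bdy' := hy' s u _ hs hsu huT hsu'
  have bdz' := hz' s u _ hs hsu huT hsu'
  have bry := hry s u _ hs hsu huT hsu'
  have brz := hrz u t _ hu hut ht hut'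
  have bz := hz u t _ hu hut ht hut'
  rw [e2] at bxx bry brz
  rw [e3, roughGerm_add_sub (hX.chen s u t hs hsu.le hut.le ht)]
  set a := (t - s) ^ α
  have hyx : ‖Y' s (X u - X s)‖ ≤ my' * (cx * a) :=
    (Y' s).le_of_opNorm_le_of_le (hby' s hs hsT) bx₁
  have i₁ := (Rem X Y Y' s u).le_of_opNorm_le_of_le bry bz
  have i₂ := (Y' s (X u - X s)).le_of_opNorm_le_of_le hyx brz
  have i₃ := (Y' s (X u - X s)).le_of_opNorm_le_of_le hyx
    ((Z' u - Z' s).le_of_opNorm_le_of_le bdz' bx₂)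
  have i₄ := (tops.spair (Y' u - Y' s) (Z' u)).le_of_opNorm_le_of_le
    ((tops.spair_le _ _).trans (mul_le_mul bdy' (hbz' u hu huT) (norm_nonneg _) (by positivity)))
    bxx
  have i₅ := (tops.spair (Y' s) (Z' u - Z' s)).le_of_opNorm_le_of_le
    ((tops.spair_le _ _).trans (mul_le_mul (hby' s hs hsT) bdz' (norm_nonneg _) hmy')) bxx
  refine (norm_add_le_of_le (norm_add₃_le.trans (add_le_add_three i₁ i₂ i₃))
    (norm_add_le_of_le i₄ i₅)).trans_eq ?_
  ring

end Germ


/-- the rough integral path is itself a controlled rough path,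
with Gubinelli derivative `t ↦ Y_t ∘ Z'_t`. -/
theorem stmt6
    {V V2 W U : Type*} [NormedAddCommGroup V] [NormedSpace ℝ V] [CompleteSpace V]
    [NormedAddCommGroup V2] [NormedSpace ℝ V2] [CompleteSpace V2]
    [NormedAddCommGroup W] [NormedSpace ℝ W] [CompleteSpace W]
    [NormedAddCommGroup U] [NormedSpace ℝ U] [CompleteSpace U]
    (T α : ℝ) (hT : 0 < T) (hα : 1 / 3 < α) (hα' : α ≤ 1 / 2)
    (tops : TensorOps V V2 W U) (X : ℝ → V) (XX : ℝ → ℝ → V2)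
    (hX : IsRoughPath T α tops.tmul X XX)
    (Y : ℝ → W →L[ℝ] U) (Y' : ℝ → V →L[ℝ] (W →L[ℝ] U)) (hY : IsCRP T α X Y Y')
    (Z : ℝ → W) (Z' : ℝ → V →L[ℝ] W) (hZ : IsCRP T α X Z Z')
    (I : ℝ → U)
    (hI : ∀ t : ℝ, 0 ≤ t → t ≤ T → IsRoughIntegral tops XX Y Y' Z Z' 0 t (I t)) :
    IsCRP T α X I fun t => (Y t).comp (Z' t) := by
  have hα0 : 0 ≤ α := by linarith
  obtain ⟨C, hC⟩ := exists_roughGerm_bound hα0 hX hY hZ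
  obtain ⟨my, hmy, hby⟩ := (hY.path_hold hX.x_hold hα0).bounded hα0
  obtain ⟨my', hmy', hby'⟩ := hY.deriv_hold.bounded hα0
  obtain ⟨mz', hmz', hbz'⟩ := hZ.deriv_hold.bounded hα0
  constructor
  · have h₁ : HBound T α fun s t => (Y t - Y s).comp (Z' t) :=
      (hY.path_hold hX.x_hold hα0).of_norm_le hmz' fun s t hs hst ht => by
        rw [mul_comm]
        exact (ContinuousLinearMap.opNorm_comp_le _ _).trans
          (mul_le_mul_of_nonneg_left (hbz' t (by linarith) ht) (norm_nonneg _))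
    have h₂ : HBound T α fun s t => (Y s).comp (Z' t - Z' s) :=
      hZ.deriv_hold.of_norm_le hmy fun s t hs hst ht =>
        (ContinuousLinearMap.opNorm_comp_le _ _).trans
          (mul_le_mul_of_nonneg_right (hby s hs (by linarith)) (norm_nonneg _))
    refine (h₁.add h₂).congr fun s t _ _ _ => ?_
    ext v
    simp
  · have h₁ : HBound T (3 * α) fun s t => I t - I s - roughGerm tops XX Y Y' Z Z' s t :=
      ⟨_, fun s t hs hst ht => norm_increment_sub_le (roughGerm tops XX Y Y' Z Z') (by linarith)
        (fun s t hs hst ht => hC s _ t hs (by linarith) (by linarith) ht) I hI hs hst ht⟩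
    have h₂ : HBound T (2 * α) fun s t => Y s (Rem X Z Z' s t) :=
      hZ.rem_hold.of_norm_le hmy fun s t hs hst ht =>
        (Y s).le_of_opNorm_le (hby s hs (by linarith)) _
    have h₃ : HBound T (2 * α) fun s t => tops.spair (Y' s) (Z' s) (XX s t) :=
      hX.xx_hold.of_norm_le (mul_nonneg hmy' hmz') fun s t hs hst ht =>
        ContinuousLinearMap.le_of_opNorm_le _ ((tops.spair_le _ _).trans
          (mul_le_mul (hby' s hs (by linarith)) (hbz' s hs (by linarith)) (norm_nonneg _) hmy')) _
    refine (((h₁.mono_exponent (by linarith) (by linarith)).add h₂).add h₃).congr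
      fun s t _ _ _ => ?_
    simp only [Rem, roughGerm, ContinuousLinearMap.comp_apply, map_sub]
    abel
end

section
/- Let 𝐗 = (X,𝕏) be a level-2 α-Hölder rough path over V, let 𝐘 = (Y,Y') be an 𝐗-controlled rough path with values in W, and let F ∈ C_b^2(W,U). Then the controlled rough path F(𝐘) := (F ∘ Y, t ↦ DF(Y_t) ∘ Y'_t) satisfies ‖F(𝐘)‖_{𝐗;α} ≤ 8 ‖F‖_{C_b^2} (1 + T^α + T^{2α}) (1 + ‖Y'_0‖ + ‖Y'_0‖²) (1 + ‖𝐗‖_α)² (1 + ‖𝐘‖_{𝐗;α})². -/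
/-!  Common definitions: level-2 rough paths, controlled rough paths,
compensated Riemann sums and rough integrals of a controlled rough path
against another controlled rough path. -/

open scoped BigOperators

section HolderSeminorm

variable {E : Type*} [NormedAddCommGroup E] {T β : ℝ} {A : ℝ → ℝ → E}

lemma hnorm_nonneg : 0 ≤ hnorm T β A :=
  Real.sInf_nonneg fun _ h => h.1

lemma hnorm_le {C : ℝ} (hC : 0 ≤ C)
    (h : ∀ s t : ℝ, 0 ≤ s → s < t → t ≤ T → ‖A s t‖ ≤ C * (t - s) ^ β) :
    hnorm T β A ≤ C :=
  csInf_le ⟨0, fun _ h => h.1⟩ ⟨hC, h⟩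

lemma HBound.norm_le (h : HBound T β A) {s t : ℝ} (hs : 0 ≤ s) (hst : s < t) (ht : t ≤ T) :
    ‖A s t‖ ≤ hnorm T β A * (t - s) ^ β := by
  have hpos : 0 < (t - s) ^ β := Real.rpow_pos_of_pos (sub_pos.2 hst) _
  rw [← div_le_iff₀ hpos]
  obtain ⟨C, hC⟩ := h
  refine le_csInf ⟨max C 0, le_max_right _ _, fun s t hs hst ht => (hC s t hs hst ht).trans ?_⟩
    fun D hD => (div_le_iff₀ hpos).2 (hD.2 s t hs hst ht)
  exact mul_le_mul_of_nonneg_right (le_max_left _ _) (Real.rpow_nonneg (sub_pos.2 hst).le _)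

end HolderSeminorm

section BoundedDerivatives

variable {E₁ E₂ : Type*} [NormedAddCommGroup E₁] [NormedSpace ℝ E₁]
  [NormedAddCommGroup E₂] [NormedSpace ℝ E₂] {F : E₁ → E₂}

lemma IsCb.norm_iteratedFDeriv_le {k j : ℕ} (hF : IsCb k F) (hj : j ≤ k) (x : E₁) :
    ‖iteratedFDeriv ℝ j F x‖ ≤ ⨆ x : E₁, ‖iteratedFDeriv ℝ j F x‖ := by
  obtain ⟨C, hC⟩ := hF.2 j hj
  exact le_ciSup (f := fun x => ‖iteratedFDeriv ℝ j F x‖)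
    ⟨C, by rintro _ ⟨y, rfl⟩; exact hC y⟩ x

lemma iSup_norm_iteratedFDeriv_le_cbNorm {k j : ℕ} (hj : j ≤ k) :
    ⨆ x : E₁, ‖iteratedFDeriv ℝ j F x‖ ≤ cbNorm k F :=
  Finset.single_le_sum (f := fun j => ⨆ x : E₁, ‖iteratedFDeriv ℝ j F x‖)
    (fun _ _ => Real.iSup_nonneg fun _ => norm_nonneg _)
    (Finset.mem_range.2 (Nat.lt_succ_of_le hj))

lemma IsCb.norm_fderiv_le (hF : IsCb 2 F) (x : E₁) : ‖fderiv ℝ F x‖ ≤ cbNorm 2 F := by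
  rw [← norm_iteratedFDeriv_one]
  exact (hF.norm_iteratedFDeriv_le one_le_two x).trans
    (iSup_norm_iteratedFDeriv_le_cbNorm one_le_two)

lemma IsCb.norm_fderiv_fderiv_le (hF : IsCb 2 F) (x : E₁) :
    ‖fderiv ℝ (fderiv ℝ F) x‖ ≤ cbNorm 2 F := by
  rw [← norm_iteratedFDeriv_one, norm_iteratedFDeriv_fderiv]
  exact (hF.norm_iteratedFDeriv_le le_rfl x).trans
    (iSup_norm_iteratedFDeriv_le_cbNorm le_rfl)

lemma IsCb.norm_fderiv_sub_le (hF : IsCb 2 F) (x y : E₁) :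
    ‖fderiv ℝ F y - fderiv ℝ F x‖ ≤ cbNorm 2 F * ‖y - x‖ := by
  have hd : ContDiff ℝ 1 (fderiv ℝ F) :=
    ContDiff.fderiv_right (m := 1) (n := 2) hF.1 (by norm_num)
  exact convex_univ.norm_image_sub_le_of_norm_fderiv_le
    (fun z _ => hd.differentiable (by norm_num) z) (fun z _ => hF.norm_fderiv_fderiv_le z)
    (Set.mem_univ x) (Set.mem_univ y)

lemma IsCb.norm_taylor_le (hF : IsCb 2 F) (x y : E₁) :
    ‖F y - F x - fderiv ℝ F x (y - x)‖ ≤ cbNorm 2 F * ‖y - x‖ ^ 2 := by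
  have hd : Differentiable ℝ F := hF.1.differentiable (by norm_num)
  have hK : 0 ≤ cbNorm 2 F := (norm_nonneg _).trans (hF.norm_fderiv_le x)
  rw [pow_two, ← mul_assoc]
  refine (convex_closedBall x ‖y - x‖).norm_image_sub_le_of_norm_fderiv_le'
    (fun z _ => hd z) (fun z hz => ?_) (Metric.mem_closedBall_self (norm_nonneg _))
    (mem_closedBall_iff_norm.2 le_rfl)
  exact (hF.norm_fderiv_sub_le x z).trans
    (mul_le_mul_of_nonneg_left (mem_closedBall_iff_norm.1 hz) hK)

end BoundedDerivatives

section ControlledPath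

variable {V E : Type*} [NormedAddCommGroup V] [NormedSpace ℝ V]
  [NormedAddCommGroup E] [NormedSpace ℝ E] {T α : ℝ} {X : ℝ → V} {Y : ℝ → E}
  {Y' : ℝ → V →L[ℝ] E}

lemma hnorm_rem_le_crpNorm : hnorm T (2 * α) (Rem X Y Y') ≤ crpNorm T α X Y Y' :=
  le_add_of_nonneg_right hnorm_nonneg

lemma hnorm_deriv_le_crpNorm :
    hnorm T α (fun s t => Y' t - Y' s) ≤ crpNorm T α X Y Y' :=
  le_add_of_nonneg_left hnorm_nonneg

lemma crpNorm_nonneg : 0 ≤ crpNorm T α X Y Y' :=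
  add_nonneg hnorm_nonneg hnorm_nonneg

lemma IsCRP.norm_deriv_le (hY : IsCRP T α X Y Y') (hα : 0 ≤ α) {t : ℝ} (ht0 : 0 ≤ t)
    (ht : t ≤ T) : ‖Y' t‖ ≤ ‖Y' 0‖ + crpNorm T α X Y Y' * T ^ α := by
  rcases ht0.eq_or_lt with rfl | hpos
  · exact le_add_of_nonneg_right (mul_nonneg crpNorm_nonneg (Real.rpow_nonneg ht _))
  · have h := hY.deriv_hold.norm_le le_rfl hpos ht
    have h2 : hnorm T α (fun s t => Y' t - Y' s) * (t - 0) ^ α ≤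
        crpNorm T α X Y Y' * T ^ α := by
      rw [sub_zero]
      exact mul_le_mul hnorm_deriv_le_crpNorm (Real.rpow_le_rpow ht0 ht hα)
        (Real.rpow_nonneg ht0 _) crpNorm_nonneg
    linarith [norm_sub_norm_le (Y' t) (Y' 0)]

lemma IsCRP.norm_sub_le (hY : IsCRP T α X Y Y') (hα : 0 ≤ α)
    (hX : HBound T α fun s t => X t - X s) {s t : ℝ} (hs : 0 ≤ s) (hst : s < t) (ht : t ≤ T) :
    ‖Y t - Y s‖ ≤ (‖Y' 0‖ + crpNorm T α X Y Y' * T ^ α) *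
      (1 + hnorm T α fun s t => X t - X s) * (t - s) ^ α := by
  have hpos : 0 < t - s := sub_pos.2 hst
  set h := (t - s) ^ α
  set a := hnorm T α fun s t => X t - X s
  set n := crpNorm T α X Y Y'
  have hh : 0 ≤ h := Real.rpow_nonneg hpos.le _
  have hn : 0 ≤ n := crpNorm_nonneg
  have hhT : h ≤ T ^ α := Real.rpow_le_rpow hpos.le (by linarith) hα
  have hR : ‖Rem X Y Y' s t‖ ≤ n * (T ^ α * h) := by
    refine (hY.rem_hold.norm_le hs hst ht).trans ?_
    have hpow : (t - s) ^ (2 * α) = h * h := by rw [two_mul, Real.rpow_add hpos]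
    rw [hpow]
    have hrn : hnorm T (2 * α) (Rem X Y Y') ≤ n := hnorm_rem_le_crpNorm
    have hhh : h * h ≤ T ^ α * h := mul_le_mul_of_nonneg_right hhT hh
    exact mul_le_mul hrn hhh (mul_nonneg hh hh) hn
  have hX' : ‖Y' s (X t - X s)‖ ≤ (‖Y' 0‖ + n * T ^ α) * (a * h) :=
    (Y' s).le_opNorm_of_le le_rfl |>.trans
      (mul_le_mul (hY.norm_deriv_le hα hs (hst.le.trans ht)) (hX.norm_le hs hst ht)
        (norm_nonneg _) (add_nonneg (norm_nonneg _) (mul_nonneg hn (hh.trans hhT))))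
  calc ‖Y t - Y s‖ = ‖Y' s (X t - X s) + Rem X Y Y' s t‖ := by
        congr 1; simp only [Rem]; abel
    _ ≤ (‖Y' 0‖ + n * T ^ α) * (a * h) + n * (T ^ α * h) := norm_add_le_of_le hX' hR
    _ ≤ (‖Y' 0‖ + n * T ^ α) * (1 + a) * h := by
        linarith [mul_nonneg (norm_nonneg (Y' 0)) hh]

end ControlledPath

/-- quantitative bound on the controlled norm of `F(𝐘)`. -/
theorem stmt9
    {V V2 W U : Type*} [NormedAddCommGroup V] [NormedSpace ℝ V] [CompleteSpace V]
    [NormedAddCommGroup V2] [NormedSpace ℝ V2] [CompleteSpace V2]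
    [NormedAddCommGroup W] [NormedSpace ℝ W] [CompleteSpace W]
    [NormedAddCommGroup U] [NormedSpace ℝ U] [CompleteSpace U]
    (T α : ℝ) (hT : 0 < T) (hα : 1 / 3 < α) (hα' : α ≤ 1 / 2)
    (tmul : V →L[ℝ] V →L[ℝ] V2) (htmul : ∀ a b : V, ‖tmul a b‖ ≤ ‖a‖ * ‖b‖)
    (X : ℝ → V) (XX : ℝ → ℝ → V2) (hX : IsRoughPath T α tmul X XX)
    (Y : ℝ → W) (Y' : ℝ → V →L[ℝ] W) (hY : IsCRP T α X Y Y')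
    (F : W → U) (hF : IsCb 2 F) :
    crpNorm T α X (fun t => F (Y t)) (fun t => (fderiv ℝ F (Y t)).comp (Y' t)) ≤
      8 * cbNorm 2 F * (1 + T ^ α + T ^ (2 * α)) * (1 + ‖Y' 0‖ + ‖Y' 0‖ ^ 2) *
        (1 + rpNorm T α X XX) ^ 2 * (1 + crpNorm T α X Y Y') ^ 2 := by
  have hα0 : 0 ≤ α := by linarith
  have hK : 0 ≤ cbNorm 2 F := (norm_nonneg _).trans (hF.norm_fderiv_le 0)
  set K := cbNorm 2 F
  set n := crpNorm T α X Y Y' with hn_def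
  have hn : 0 ≤ n := crpNorm_nonneg
  have hτ : 0 ≤ T ^ α := Real.rpow_nonneg hT.le _
  have hτ2 : T ^ (2 * α) = (T ^ α) ^ 2 := by rw [two_mul, Real.rpow_add hT, pow_two]
  have hy : 0 ≤ ‖Y' 0‖ := norm_nonneg _
  set a := hnorm T α fun s t => X t - X s
  have ha : 0 ≤ a := hnorm_nonneg
  have haρ : a ≤ rpNorm T α X XX := le_add_of_nonneg_right hnorm_nonneg
  set M := ‖Y' 0‖ + n * T ^ α with hM_def
  have hM : 0 ≤ M := by positivity
  set L := M * (1 + a) with hL_def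
  have hL : 0 ≤ L := by positivity
  have hYsub : ∀ s t : ℝ, 0 ≤ s → s < t → t ≤ T → ‖Y t - Y s‖ ≤ L * (t - s) ^ α :=
    fun s t hs hst ht => hY.norm_sub_le hα0 hX.x_hold hs hst ht
  have hD : hnorm T α (fun s t => (fderiv ℝ F (Y t)).comp (Y' t) -
      (fderiv ℝ F (Y s)).comp (Y' s)) ≤
      K * hnorm T α (fun s t => Y' t - Y' s) + K * L * M := by
    have hd := hnorm_nonneg (T := T) (β := α) (A := fun s t => Y' t - Y' s)
    refine hnorm_le (by positivity) fun s t hs hst ht => ?_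
    have hh : 0 ≤ (t - s) ^ α := Real.rpow_nonneg (sub_pos.2 hst).le _
    have h1 : ‖(fderiv ℝ F (Y t)).comp (Y' t - Y' s)‖ ≤
        K * (hnorm T α (fun s t => Y' t - Y' s) * (t - s) ^ α) :=
      (ContinuousLinearMap.opNorm_comp_le _ _).trans
        (mul_le_mul (hF.norm_fderiv_le _) (hY.deriv_hold.norm_le hs hst ht) (norm_nonneg _) hK)
    have h2 : ‖(fderiv ℝ F (Y t) - fderiv ℝ F (Y s)).comp (Y' s)‖ ≤
        K * (L * (t - s) ^ α) * M :=
      (ContinuousLinearMap.opNorm_comp_le _ _).trans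
        (mul_le_mul ((hF.norm_fderiv_sub_le _ _).trans
          (mul_le_mul_of_nonneg_left (hYsub s t hs hst ht) hK))
          (hY.norm_deriv_le hα0 hs (hst.le.trans ht)) (norm_nonneg _) (by positivity))
    calc _ = ‖(fderiv ℝ F (Y t)).comp (Y' t - Y' s) +
          (fderiv ℝ F (Y t) - fderiv ℝ F (Y s)).comp (Y' s)‖ := by
          congr 1; ext v; simp
      _ ≤ _ := norm_add_le_of_le h1 h2
      _ = _ := by ring
  have hR : hnorm T (2 * α) (Rem X (fun t => F (Y t))
      (fun t => (fderiv ℝ F (Y t)).comp (Y' t))) ≤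
      K * hnorm T (2 * α) (Rem X Y Y') + K * L ^ 2 := by
    have hr := hnorm_nonneg (T := T) (β := 2 * α) (A := Rem X Y Y')
    refine hnorm_le (by positivity) fun s t hs hst ht => ?_
    have h1 : ‖fderiv ℝ F (Y s) (Rem X Y Y' s t)‖ ≤
        K * (hnorm T (2 * α) (Rem X Y Y') * (t - s) ^ (2 * α)) :=
      (ContinuousLinearMap.le_opNorm _ _).trans
        (mul_le_mul (hF.norm_fderiv_le _) (hY.rem_hold.norm_le hs hst ht) (norm_nonneg _) hK)
    have h2 : ‖F (Y t) - F (Y s) - fderiv ℝ F (Y s) (Y t - Y s)‖ ≤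
        K * (L * (t - s) ^ α) ^ 2 :=
      (hF.norm_taylor_le _ _).trans (mul_le_mul_of_nonneg_left
        (pow_le_pow_left₀ (norm_nonneg _) (hYsub s t hs hst ht) 2) hK)
    have hpow : (t - s) ^ (2 * α) = ((t - s) ^ α) ^ 2 := by
      rw [two_mul, Real.rpow_add (sub_pos.2 hst), pow_two]
    calc _ = ‖fderiv ℝ F (Y s) (Rem X Y Y' s t) +
          (F (Y t) - F (Y s) - fderiv ℝ F (Y s) (Y t - Y s))‖ := by
          congr 1; simp [Rem]
      _ ≤ _ := norm_add_le_of_le h1 h2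
      _ = _ := by rw [hpow]; ring
  have hsum : crpNorm T α X (fun t => F (Y t)) (fun t => (fderiv ℝ F (Y t)).comp (Y' t)) ≤
      K * (n + L * M + L ^ 2) := by
    rw [hn_def]
    unfold crpNorm
    linarith
  have hML : M ≤ L := le_mul_of_one_le_right hM (by linarith)
  have hM2 : M ^ 2 ≤
      2 * ((1 + T ^ α + (T ^ α) ^ 2) * (1 + ‖Y' 0‖ + ‖Y' 0‖ ^ 2) * (1 + n) ^ 2) := by
    have h1 : M ^ 2 ≤ 2 * (‖Y' 0‖ ^ 2 + n ^ 2 * (T ^ α) ^ 2) := by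
      rw [hM_def]; nlinarith [sq_nonneg (‖Y' 0‖ - n * T ^ α)]
    have h2 : ‖Y' 0‖ ^ 2 + n ^ 2 * (T ^ α) ^ 2 ≤
        (1 + (T ^ α) ^ 2) * (1 + ‖Y' 0‖ ^ 2) * (1 + n ^ 2) := by
      have : 0 ≤ ‖Y' 0‖ ^ 2 * n ^ 2 * (1 + (T ^ α) ^ 2) + ‖Y' 0‖ ^ 2 * (T ^ α) ^ 2 +
        1 + n ^ 2 + (T ^ α) ^ 2 := by positivity
      linarith
    have h3 : (1 + (T ^ α) ^ 2) * (1 + ‖Y' 0‖ ^ 2) * (1 + n ^ 2) ≤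
        (1 + T ^ α + (T ^ α) ^ 2) * (1 + ‖Y' 0‖ + ‖Y' 0‖ ^ 2) * (1 + n) ^ 2 := by
      gcongr
      · linarith
      · linarith
      · linarith [show (1 + n) ^ 2 = 1 + n ^ 2 + 2 * n by ring]
    linarith
  rw [hτ2]
  set P := (1 + T ^ α + (T ^ α) ^ 2) * (1 + ‖Y' 0‖ + ‖Y' 0‖ ^ 2) * (1 + n) ^ 2 with hP_def
  have hnP : n ≤ P := by
    have h1 : 1 ≤ (1 + T ^ α + (T ^ α) ^ 2) * (1 + ‖Y' 0‖ + ‖Y' 0‖ ^ 2) :=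
      one_le_mul_of_one_le_of_one_le (by linarith [sq_nonneg (T ^ α)])
        (by linarith [sq_nonneg ‖Y' 0‖])
    calc n ≤ (1 + n) ^ 2 := by nlinarith
      _ ≤ P := le_mul_of_one_le_left (by positivity) h1
  have hP : 0 ≤ P := hn.trans hnP
  have hbr : n + L * M + L ^ 2 ≤ 8 * (P * (1 + rpNorm T α X XX) ^ 2) := by
    have h1 : L * M ≤ L ^ 2 := by
      rw [pow_two]; exact mul_le_mul_of_nonneg_left hML hL
    have h2 : L ^ 2 ≤ 2 * P * (1 + a) ^ 2 := by
      rw [hL_def, mul_pow]; exact mul_le_mul_of_nonneg_right hM2 (by positivity)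
    have h3 : P ≤ P * (1 + a) ^ 2 :=
      le_mul_of_one_le_right hP (one_le_pow₀ (le_add_of_nonneg_right ha))
    have h4 : P * (1 + a) ^ 2 ≤ P * (1 + rpNorm T α X XX) ^ 2 := by gcongr
    linarith
  calc _ ≤ K * (n + L * M + L ^ 2) := hsum
    _ ≤ K * (8 * (P * (1 + rpNorm T α X XX) ^ 2)) := mul_le_mul_of_nonneg_left hbr hK
    _ = _ := by rw [hP_def]; ring
end
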